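/- Let V be a finite-dimensional real vector space, let A : V →ₗ[ℝ] V be bijective, let B : V →ₗ[ℝ] V be arbitrary, and let ξ ≠ 0 be a real number. Then the block linear map L : V × V → V × V defined by L(φ, n) = (−A φ − B n, −A φ + ξ·n − B n) is bijective. In particular, the implicit scheme is well posed in the quasi-neutral limit λ = 0. -/

import Mathlib

/-- For a finite-dimensional real vector space `V`, a bijective
`A : V →ₗ[ℝ] V` (ellipticity of `−Δ∥,n_e^k`), arbitrary `B : V →ₗ[ℝ] V` and `ξ ≠ 0`,
the block map `L(φ, n) = (−Aφ − Bn, −Aφ + ξ·n − Bn)` on `V × V` is bijective: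
the implicit scheme is well posed in the quasi-neutral limit `λ = 0`. -/
theorem implicit_scheme_wellposed_quasineutral_limit
    (V : Type*) [AddCommGroup V] [Module ℝ V] [FiniteDimensional ℝ V]
    (A B : V →ₗ[ℝ] V) (hA : Function.Bijective A) (ξ : ℝ) (hξ : ξ ≠ 0) :
    Function.Bijective
      (fun p : V × V => ((- A p.1 - B p.2, - A p.1 + ξ • p.2 - B p.2) : V × V)) := by
  constructor
  · rintro ⟨φ, n⟩ ⟨ψ, m⟩ h
    obtain ⟨h₁, h₂⟩ := Prod.mk.inj h
    dsimp only at h₁ h₂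
    have hsmul : ξ • n = ξ • m := by
      calc ξ • n = (- A φ + ξ • n - B n) - (- A φ - B n) := by abel
        _ = (- A ψ + ξ • m - B m) - (- A ψ - B m) := by rw [h₁, h₂]
        _ = ξ • m := by abel
    obtain rfl : n = m := smul_right_injective V hξ hsmul
    obtain rfl : φ = ψ := hA.injective (neg_injective (sub_left_injective h₁))
    rfl
  · rintro ⟨f, g⟩
    obtain ⟨φ, hφ⟩ := hA.surjective (- f - B (ξ⁻¹ • (g - f)))
    refine ⟨(φ, ξ⁻¹ • (g - f)), Prod.ext ?_ ?_⟩
    · dsimp only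
      rw [hφ]
      abel
    · dsimp only
      rw [hφ, smul_inv_smul₀ hξ]
      abel
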